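/- Suppose n ≥ 5 and S is an orientable sequence of order n with period m. Then: if n ≡ 0 (mod 4), m ≤ 2^{n-1} − (41/9)·2^{n/2−1} + n/3 + 16/9; if n ≡ 1 (mod 4), m ≤ 2^{n-1} − (31/9)·2^{(n-1)/2} + n/3 + 19/9; if n ≡ 2 (mod 4), m ≤ 2^{n-1} − (41/9)·2^{n/2−1} + n/6 + 20/9; and if n ≡ 3 (mod 4), m ≤ 2^{n-1} − (31/9)·2^{(n-1)/2} + n/6 + 43/18 (the bounds being rational numbers). -/

import Mathlib

/-- A sequence has `m` as a (not necessarily least) period. -/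
def hasPer (s : ℕ → Bool) (m : ℕ) : Prop := ∀ i, s (i + m) = s i

/-- `m` is the (least positive) period of `s`. -/
def isPeriod (s : ℕ → Bool) (m : ℕ) : Prop :=
  0 < m ∧ hasPer s m ∧ ∀ k, 0 < k → hasPer s k → m ≤ k

/-- The `n`-tuple appearing at position `i` of `s`. -/
def tup (s : ℕ → Bool) (n i : ℕ) : Fin n → Bool := fun k => s (i + (k : ℕ))

/-- The reverse of an `n`-tuple. -/
def tupRev {n : ℕ} (u : Fin n → Bool) : Fin n → Bool := fun k => u k.rev

/-- An `n`-window sequence of period `m`. -/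
def isNWindow (s : ℕ → Bool) (n m : ℕ) : Prop :=
  isPeriod s m ∧ ∀ i j, tup s n i = tup s n j → i ≡ j [MOD m]

/-- The weight of (one period of) `s`. -/
def wt (s : ℕ → Bool) (m : ℕ) : ℕ := ∑ i ∈ Finset.range m, (if s i then 1 else 0)

/-- The complement of a sequence. -/
def seqCompl (s : ℕ → Bool) : ℕ → Bool := fun i => !(s i)

/-- Two sequences are disjoint if they share no `n`-tuple. -/
def disjointSeq (s t : ℕ → Bool) (n : ℕ) : Prop := ∀ i j, tup s n i ≠ tup t n j

/-- A sequence is primitive if it is disjoint from its complement. -/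
def primitiveSeq (s : ℕ → Bool) (n : ℕ) : Prop := disjointSeq s (seqCompl s) n

/-- An orientable sequence of order `n` and period `m`. -/
def isOrientable (s : ℕ → Bool) (n m : ℕ) : Prop :=
  isNWindow s n m ∧ ∀ i j, tup s n i ≠ tupRev (tup s n j)

/-- Two sequences are o-disjoint: disjoint, and no `n`-tuple of one is the
reverse of an `n`-tuple of the other. -/
def oDisjoint (s t : ℕ → Bool) (n : ℕ) : Prop :=
  disjointSeq s t n ∧ ∀ i j, tup s n i ≠ tupRev (tup t n j)

/-- The Lempel homomorphism `D` on periodic sequences. -/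
def Dmap (t : ℕ → Bool) : ℕ → Bool := fun i => xor (t i) (t (i + 1))

/-- The set `D⁻¹(s)` of sequences mapping to `s` under `D`. -/
def Dinv (s : ℕ → Bool) : Set (ℕ → Bool) := { t | Dmap t = s }

/-! ### Proof

Words of length `n` are coded by naturals below `2 ^ n` (least significant bit first).
They are the edges of the de Bruijn graph on words of length `n - 1`.
The windows of `s` and their reverses avoid a set `F` of edges; a potential on the vertices
bounds from below the number of edges that are not used. -/

/-- code of the window at `i` -/
def codeW (s : ℕ → Bool) (n i : ℕ) : ℕ := Nat.ofBits (tup s n i)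

/-- code of the reversed window at `i` -/
def codeU (s : ℕ → Bool) (n i : ℕ) : ℕ := Nat.ofBits (tupRev (tup s n i))

/-- code of a palindrome -/
def isPal (n e : ℕ) : Prop := ∀ k, k < n → e.testBit k = e.testBit (n - 1 - k)

instance (n e : ℕ) : Decidable (isPal n e) := by unfold isPal; infer_instance

/-- reduced cost of an edge -/
def rcost (n : ℕ) (φ : ℕ → ℤ) (e : ℕ) : ℤ := 1 + φ (e % 2 ^ (n - 1)) - φ (e / 2)

lemma testBit_codeW (s : ℕ → Bool) (n i k : ℕ) :
    (codeW s n i).testBit k = if k < n then s (i + k) else false := by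
  unfold codeW
  split_ifs with h
  · rw [Nat.testBit_ofBits_lt _ _ h]; rfl
  · rw [Nat.testBit_ofBits_ge _ _ (by omega)]

lemma testBit_codeU (s : ℕ → Bool) (n i k : ℕ) :
    (codeU s n i).testBit k = if k < n then s (i + (n - 1 - k)) else false := by
  unfold codeU
  split_ifs with h
  · rw [Nat.testBit_ofBits_lt _ _ h]
    simp only [tupRev, tup, Fin.val_rev]
    congr 2; omega
  · rw [Nat.testBit_ofBits_ge _ _ (by omega)]

lemma codeW_mod (s : ℕ → Bool) (n i : ℕ) :
    codeW s n i % 2 ^ (n - 1) = codeW s (n - 1) i := by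
  apply Nat.eq_of_testBit_eq; intro k
  rw [Nat.testBit_mod_two_pow, testBit_codeW, testBit_codeW]
  by_cases h : k < n - 1
  · simp [h, show k < n by omega]
  · simp [h]

lemma codeW_div (s : ℕ → Bool) (n i : ℕ) :
    codeW s n i / 2 = codeW s (n - 1) (i + 1) := by
  apply Nat.eq_of_testBit_eq; intro k
  rw [Nat.testBit_div_two, testBit_codeW, testBit_codeW]
  by_cases h : k < n - 1
  · simp only [h, show k + 1 < n by omega, if_true]; congr 1; omega
  · simp [h, show ¬ k + 1 < n by omega]

lemma codeU_mod (s : ℕ → Bool) (n i : ℕ) :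
    codeU s n i % 2 ^ (n - 1) = codeU s (n - 1) (i + 1) := by
  apply Nat.eq_of_testBit_eq; intro k
  rw [Nat.testBit_mod_two_pow, testBit_codeU, testBit_codeU]
  by_cases h : k < n - 1
  · simp only [h, show k < n by omega, if_true, decide_true, Bool.true_and]; congr 1; omega
  · simp [h]

lemma codeU_div (s : ℕ → Bool) (n i : ℕ) :
    codeU s n i / 2 = codeU s (n - 1) i := by
  apply Nat.eq_of_testBit_eq; intro k
  rw [Nat.testBit_div_two, testBit_codeU, testBit_codeU]
  by_cases h : k < n - 1
  · simp only [h, show k + 1 < n by omega, if_true]; congr 1; omega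
  · simp [h, show ¬ k + 1 < n by omega]

lemma ofBits_inj {n : ℕ} {f g : Fin n → Bool} (h : Nat.ofBits f = Nat.ofBits g) : f = g := by
  funext k
  have := congrArg (fun x => x.testBit k) h
  simpa [Nat.testBit_ofBits_lt _ _ k.2] using this

lemma sum_div_two (φ : ℕ → ℤ) (N : ℕ) :
    ∑ e ∈ Finset.range (2 * N), φ (e / 2) = 2 * ∑ v ∈ Finset.range N, φ v := by
  induction N with
  | zero => simp
  | succ N ih =>
    rw [show 2 * (N + 1) = 2 * N + 1 + 1 by ring, Finset.sum_range_succ, Finset.sum_range_succ, ih,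
      Finset.sum_range_succ, show (2 * N + 1) / 2 = N by omega, show 2 * N / 2 = N by omega]
    ring

lemma sum_mod_two (φ : ℕ → ℤ) (N : ℕ) :
    ∑ e ∈ Finset.range (2 * N), φ (e % N) = 2 * ∑ v ∈ Finset.range N, φ v := by
  rw [two_mul, Finset.sum_range_add]
  have h1 : ∀ v ∈ Finset.range N, φ (v % N) = φ v := by
    intro v hv; rw [Nat.mod_eq_of_lt (Finset.mem_range.1 hv)]
  have h2 : ∀ v ∈ Finset.range N, φ ((N + v) % N) = φ v := by
    intro v hv; rw [Nat.add_mod_left, Nat.mod_eq_of_lt (Finset.mem_range.1 hv)]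
  rw [Finset.sum_congr rfl h1, Finset.sum_congr rfl h2]; ring

lemma sum_rcost (n : ℕ) (hn : 1 ≤ n) (φ : ℕ → ℤ) :
    ∑ e ∈ Finset.range (2 ^ n), rcost n φ e = 2 ^ n := by
  unfold rcost
  rw [Finset.sum_sub_distrib, Finset.sum_add_distrib]
  have h2 : 2 ^ n = 2 * 2 ^ (n - 1) := by
    obtain ⟨k, rfl⟩ : ∃ k, n = k + 1 := ⟨n - 1, by omega⟩
    simp [pow_succ, mul_comm]
  have e1 := sum_div_two φ (2 ^ (n - 1))
  have e2 := sum_mod_two φ (2 ^ (n - 1))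
  rw [← h2] at e1 e2
  rw [e1, e2]; simp

lemma codeW_per {s : ℕ → Bool} {m : ℕ} (hp : hasPer s m) (n : ℕ) : codeW s n m = codeW s n 0 := by
  apply Nat.eq_of_testBit_eq; intro k
  rw [testBit_codeW, testBit_codeW, Nat.zero_add, Nat.add_comm, hp]

lemma codeU_per {s : ℕ → Bool} {m : ℕ} (hp : hasPer s m) (n : ℕ) : codeU s n m = codeU s n 0 := by
  apply Nat.eq_of_testBit_eq; intro k
  rw [testBit_codeU, testBit_codeU, Nat.zero_add, Nat.add_comm, hp]

lemma key (n m : ℕ) (s : ℕ → Bool) (hn : 1 ≤ n) (h : isOrientable s n m) (φ : ℕ → ℤ)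
    (F : ℕ → Prop) [DecidablePred F] (hW : ∀ i, ¬ F (codeW s n i)) (hU : ∀ i, ¬ F (codeU s n i))
    (hc : ∀ e, e < 2 ^ n → ¬ F e → 0 ≤ rcost n φ e) :
    2 * (m : ℤ) + ∑ e ∈ (Finset.range (2 ^ n)).filter F, rcost n φ e ≤ 2 ^ n := by
  obtain ⟨⟨⟨hm, hp, -⟩, hw⟩, ho⟩ := h
  have inj : ∀ i j, i < m → j < m → tup s n i = tup s n j → i = j := by
    intro i j hi hj hij
    have := hw i j hij
    rwa [Nat.ModEq, Nat.mod_eq_of_lt hi, Nat.mod_eq_of_lt hj] at this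
  have injW : Set.InjOn (codeW s n) (Finset.range m : Finset ℕ) := by
    intro i hi j hj hij
    simp only [Finset.coe_range, Set.mem_Iio] at hi hj
    exact inj i j hi hj (ofBits_inj hij)
  have injU : Set.InjOn (codeU s n) (Finset.range m : Finset ℕ) := by
    intro i hi j hj hij
    simp only [Finset.coe_range, Set.mem_Iio] at hi hj
    refine inj i j hi hj ?_
    have h1 := ofBits_inj hij
    funext k
    have := congrFun h1 k.rev
    simpa [tupRev] using this
  have disj : Disjoint ((Finset.range m).image (codeW s n)) ((Finset.range m).image (codeU s n)) := by
    rw [Finset.disjoint_left]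
    intro x hx hy
    obtain ⟨i, -, hi⟩ := Finset.mem_image.1 hx
    obtain ⟨j, -, hj⟩ := Finset.mem_image.1 hy
    exact ho i j (ofBits_inj (hi.trans hj.symm))
  have sW : ∑ e ∈ (Finset.range m).image (codeW s n), rcost n φ e = m := by
    rw [Finset.sum_image injW]
    have : ∀ i ∈ Finset.range m, rcost n φ (codeW s n i) =
        1 - (φ (codeW s (n - 1) (i + 1)) - φ (codeW s (n - 1) i)) := by
      intro i _
      rw [rcost, codeW_mod, codeW_div]; ring
    rw [Finset.sum_congr rfl this, Finset.sum_sub_distrib,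
      Finset.sum_range_sub (fun i => φ (codeW s (n - 1) i)), codeW_per hp]
    simp
  have sU : ∑ e ∈ (Finset.range m).image (codeU s n), rcost n φ e = m := by
    rw [Finset.sum_image injU]
    have : ∀ i ∈ Finset.range m, rcost n φ (codeU s n i) =
        1 + (φ (codeU s (n - 1) (i + 1)) - φ (codeU s (n - 1) i)) := by
      intro i _
      rw [rcost, codeU_mod, codeU_div]; ring
    rw [Finset.sum_congr rfl this, Finset.sum_add_distrib,
      Finset.sum_range_sub (fun i => φ (codeU s (n - 1) i)), codeU_per hp]
    simp
  have sub : (Finset.range m).image (codeW s n) ∪ (Finset.range m).image (codeU s n) ⊆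
      (Finset.range (2 ^ n)).filter (fun e => ¬ F e) := by
    intro x hx
    rw [Finset.mem_filter, Finset.mem_range]
    rcases Finset.mem_union.1 hx with hx | hx
    · obtain ⟨i, -, rfl⟩ := Finset.mem_image.1 hx
      exact ⟨Nat.ofBits_lt_two_pow _, hW i⟩
    · obtain ⟨i, -, rfl⟩ := Finset.mem_image.1 hx
      exact ⟨Nat.ofBits_lt_two_pow _, hU i⟩
  have le := Finset.sum_le_sum_of_subset_of_nonneg (f := rcost n φ) sub (by
    intro e he _
    rw [Finset.mem_filter, Finset.mem_range] at he
    exact hc e he.1 he.2)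
  rw [Finset.sum_union disj, sW, sU] at le
  have tot := Finset.sum_filter_add_sum_filter_not (Finset.range (2 ^ n)) F (rcost n φ)
  rw [sum_rcost n hn] at tot
  linarith

lemma not_pal_W {n m : ℕ} {s : ℕ → Bool} (h : isOrientable s n m) (i : ℕ) :
    ¬ isPal n (codeW s n i) := by
  intro hp
  apply h.2 i i
  funext k
  have := hp k k.2
  rw [testBit_codeW, testBit_codeW, if_pos k.2, if_pos (by omega)] at this
  simp only [tupRev, tup, Fin.val_rev]
  rw [this]; congr 1; omega

lemma not_pal_U {n m : ℕ} {s : ℕ → Bool} (h : isOrientable s n m) (i : ℕ) :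
    ¬ isPal n (codeU s n i) := by
  intro hp
  apply h.2 i i
  funext k
  have := hp k k.2
  have hk := k.2
  rw [testBit_codeU, testBit_codeU, if_pos k.2, if_pos (by omega)] at this
  simp only [tupRev, tup, Fin.val_rev]
  rw [show n - 1 - (n - 1 - (k : ℕ)) = k by omega] at this
  rw [← this]; congr 1; omega

/-- no window of length `n - 1` is constant -/
lemma not_const {n m : ℕ} {s : ℕ → Bool} (hn : 2 ≤ n) (h : isOrientable s n m) (i : ℕ) (b : Bool)
    (hb : ∀ k, k < n - 1 → s (i + k) = b) : False := by
  obtain ⟨⟨⟨hm, hp, -⟩, hw⟩, ho⟩ := h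
  have hb' : ∀ k, k < n - 1 → s (i + m + k) = b := by
    intro k hk
    rw [show i + m + k = i + k + m by ring, hp, hb k hk]
  by_cases hx : s (i + m - 1) = b
  · apply ho (i + m - 1) (i + m - 1)
    have : ∀ k, k < n → s (i + m - 1 + k) = b := by
      intro k hk
      rcases Nat.eq_zero_or_pos k with rfl | hk0
      · exact hx
      · rw [show i + m - 1 + k = i + m + (k - 1) by omega]; exact hb' _ (by omega)
    funext k
    simp only [tupRev, tup]
    rw [this _ k.2, this _ k.rev.2]
  by_cases hy : s (i + m + (n - 1)) = b
  · apply ho (i + m) (i + m)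
    have : ∀ k, k < n → s (i + m + k) = b := by
      intro k hk
      by_cases hk0 : k = n - 1
      · subst hk0; exact hy
      · exact hb' _ (by omega)
    funext k
    simp only [tupRev, tup]
    rw [this _ k.2, this _ k.rev.2]
  · have hxy : s (i + m - 1) = s (i + m + (n - 1)) := by
      revert hx hy
      cases s (i + m - 1) <;> cases s (i + m + (n - 1)) <;> cases b <;> simp
    apply ho (i + m - 1) (i + m)
    funext k
    simp only [tupRev, tup, Fin.val_rev]
    have hk := k.2
    by_cases hk0 : (k : ℕ) = 0
    · rw [hk0, Nat.add_zero, hxy]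
    · rw [hb' _ (by omega), show i + m - 1 + (k : ℕ) = i + m + (k - 1) by omega, hb' _ (by omega)]

/-- forced unused edges for small `n` -/
def forced (n e : ℕ) : Prop :=
  isPal n e ∨ e % 2 ^ (n - 1) = 0 ∨ e % 2 ^ (n - 1) = 2 ^ (n - 1) - 1 ∨
    e / 2 = 0 ∨ e / 2 = 2 ^ (n - 1) - 1

instance (n : ℕ) : DecidablePred (forced n) := by
  intro e; unfold forced; infer_instance

lemma codeW_ne {n m : ℕ} {s : ℕ → Bool} (hn : 2 ≤ n) (h : isOrientable s n m) (i : ℕ) :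
    codeW s (n - 1) i ≠ 0 ∧ codeW s (n - 1) i ≠ 2 ^ (n - 1) - 1 := by
  refine ⟨fun h0 => not_const hn h i false ?_, fun h0 => not_const hn h i true ?_⟩
  · intro k hk
    have := congrArg (fun x => x.testBit k) h0
    simpa [testBit_codeW, hk] using this
  · intro k hk
    have := congrArg (fun x => x.testBit k) h0
    simpa [testBit_codeW, hk, Nat.testBit_two_pow_sub_one] using this

lemma codeU_ne {n m : ℕ} {s : ℕ → Bool} (hn : 2 ≤ n) (h : isOrientable s n m) (i : ℕ) :
    codeU s (n - 1) i ≠ 0 ∧ codeU s (n - 1) i ≠ 2 ^ (n - 1) - 1 := by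
  refine ⟨fun h0 => not_const hn h i false ?_, fun h0 => not_const hn h i true ?_⟩
  · intro k hk
    have := congrArg (fun x => x.testBit (n - 1 - 1 - k)) h0
    simp only [testBit_codeU, Nat.zero_testBit, if_pos (show n - 1 - 1 - k < n - 1 by omega)] at this
    rw [← this]; congr 1; omega
  · intro k hk
    have := congrArg (fun x => x.testBit (n - 1 - 1 - k)) h0
    simp only [testBit_codeU, Nat.testBit_two_pow_sub_one,
      if_pos (show n - 1 - 1 - k < n - 1 by omega),
      decide_eq_true (show n - 1 - 1 - k < n - 1 by omega)] at this
    rw [← this]; congr 1; omega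

/-- table lookup: hexadecimal digit `v` of `T` -/
def tabl (T v : ℕ) : ℕ := (T >>> (4 * v)) % 16

/-- accumulate the check for edges below `N` -/
def chk (n T : ℕ) (N : ℕ) : Prop :=
  ∀ e, e < N → forced n e ∨ tabl T (e / 2) ≤ 1 + tabl T (e % 2 ^ (n - 1))

instance (n T N : ℕ) : Decidable (chk n T N) := by unfold chk; infer_instance

lemma small {n m : ℕ} {s : ℕ → Bool} (hn : 2 ≤ n) (h : isOrientable s n m) (T B : ℕ)
    (h1 : chk n T (2 ^ n))
    (h2 : B + ((List.range (2 ^ n)).filter (fun e => forced n e)).foldr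
        (fun e a => tabl T (e / 2) + a) 0 ≤
      ((List.range (2 ^ n)).filter (fun e => forced n e)).foldr
        (fun e a => 1 + tabl T (e % 2 ^ (n - 1)) + a) 0) :
    2 * m + B ≤ 2 ^ n := by
  have hk := key n m s (by omega) h (fun v => (tabl T v : ℤ)) (forced n)
    (by
      intro i
      unfold forced
      rw [codeW_mod, codeW_div]
      have a := codeW_ne hn h i
      have b := codeW_ne hn h (i + 1)
      have c := not_pal_W h i
      tauto)
    (by
      intro i
      unfold forced
      rw [codeU_mod, codeU_div]
      have a := codeU_ne hn h i
      have b := codeU_ne hn h (i + 1)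
      have c := not_pal_U h i
      tauto)
    (by
      intro e he hF
      have := (h1 e he).resolve_left hF
      unfold rcost
      have : (tabl T (e / 2) : ℤ) ≤ 1 + tabl T (e % 2 ^ (n - 1)) := by exact_mod_cast this
      linarith)
  have fold : ∀ (l : List ℕ) (g : ℕ → ℕ), l.foldr (fun e a => g e + a) 0 = (l.map g).sum := by
    intro l g
    induction l with
    | nil => rfl
    | cons x l ih => simp [ih]
  have conv : ∀ g : ℕ → ℕ, ∑ e ∈ (Finset.range (2 ^ n)).filter (forced n), g e =
      (((List.range (2 ^ n)).filter (fun e => forced n e)).map g).sum := by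
    intro g; rfl
  rw [fold, fold, ← conv, ← conv] at h2
  unfold rcost at hk
  rw [Finset.sum_sub_distrib] at hk
  zify at h2 ⊢
  linarith

lemma small_5 {m : ℕ} {s : ℕ → Bool} (h : isOrientable s 5 m) :
    2 * m + 20 ≤ 2 ^ 5 := by
  refine small (by norm_num) h
    2454763200577605922 _ ?_ ?_
  · decide +kernel
  · decide +kernel

lemma small_6 {m : ℕ} {s : ℕ → Bool} (h : isOrientable s 6 m) :
    2 * m + 30 ≤ 2 ^ 6 := by
  refine small (by norm_num) h
    68050953864494199076923760824657519411 _ ?_ ?_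
  · decide +kernel
  · decide +kernel

lemma small_7 {m : ℕ} {s : ℕ → Bool} (h : isOrientable s 7 m) :
    2 * m + 48 ≤ 2 ^ 7 := by
  refine small (by norm_num) h
    30847619346497223628993854623923060616122833757676562916276118758490458174276 _ ?_ ?_
  · decide +kernel
  · decide +kernel

lemma small_8 {m : ℕ} {s : ℕ → Bool} (h : isOrientable s 8 m) :
    2 * m + 64 ≤ 2 ^ 8 := by
  refine small (by norm_num) h
    4469051829831695588790152026946946915887263335027288214029271035442198801659369170578400778016082810389514786160769216547302401538416625464239701494089045 _ ?_ ?_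
  · decide +kernel
  · decide +kernel

lemma small_9 {m : ℕ} {s : ℕ → Bool} (h : isOrientable s 9 m) :
    2 * m + 100 ≤ 2 ^ 9 := by
  refine small (by norm_num) h
    71860728935390535570007320994776694574109764293277642216569196895443640181181774758788072735788416416075936209600316651053097764902593215125679211550281924304873861651612975612354338343363170353988139106179064897816265274756246508085807103652196223302482405833913283295203422234893851596365713170065275508070 _ ?_ ?_
  · decide +kernel
  · decide +kernel

lemma small_10 {m : ℕ} {s : ℕ → Bool} (h : isOrientable s 10 m) :
    2 * m + 138 ≤ 2 ^ 10 := by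
  refine small (by norm_num) h
    15080745545619456118947179865633399168250404854957379867626000476114183518846325021290506981726359359048114385203312070668012010061552442825466116884638090358425903146457308386749402311405542944247354391569670177856512280347004239709962618974503413471274352854044262926205904663279530645423963979216572312914835676569273916970911365223408201972148059088102456459983713632023495603969267289781503963140704891897569750637555563566944459768118996453831938642823135664390335424250155326404861193283326479904784484122306774596443300034565371285176540170454953448628162787884553187727602204430168267537209807778461085230967 _ ?_ ?_
  · decide +kernel
  · decide +kernel


/-! ### Large `n` -/

/-- palindrome with local period `2 * k` -/
def perPal (n k e : ℕ) : Prop :=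
  isPal n e ∧ ∀ i, i < n - 2 * k → e.testBit i = e.testBit (i + 2 * k)

instance (n k e : ℕ) : Decidable (perPal n k e) := by unfold perPal; infer_instance

lemma perPal_ext {n k p q : ℕ} (hk1 : 1 ≤ k) (hk : k ≤ n / 2) (hp : perPal n k p)
    (hq : perPal n k q) (hw : ∀ i, n / 2 - k ≤ i → i < n / 2 + n % 2 → p.testBit i = q.testBit i) :
    ∀ i, i < n → p.testBit i = q.testBit i := by
  have hi : ∀ i, n / 2 - k ≤ i → i < n → p.testBit i = q.testBit i := by
    intro i
    induction i using Nat.strong_induction_on with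
    | _ i ih =>
      intro h1 h2
      by_cases c1 : i < n / 2 + n % 2
      · exact hw i h1 c1
      by_cases c2 : n / 2 - k ≤ n - 1 - i
      · rw [hp.1 i h2, hq.1 i h2]
        exact hw _ c2 (by omega)
      · have e1 := hp.2 (i - 2 * k) (by omega)
        have e2 := hq.2 (i - 2 * k) (by omega)
        rw [show i - 2 * k + 2 * k = i by omega] at e1 e2
        rw [← e1, ← e2]
        exact ih _ (by omega) (by omega) (by omega)
  intro i h
  by_cases c : n / 2 - k ≤ i
  · exact hi i c h
  · rw [hp.1 i h, hq.1 i h]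
    exact hi _ (by omega) (by omega)

lemma eq_of_bits {n p q : ℕ} (hp : p < 2 ^ n) (hq : q < 2 ^ n)
    (h : ∀ i, i < n → p.testBit i = q.testBit i) : p = q := by
  apply Nat.eq_of_testBit_eq
  intro i
  by_cases c : i < n
  · exact h i c
  · have : 2 ^ n ≤ 2 ^ i := Nat.pow_le_pow_right (by norm_num) (by omega)
    rw [Nat.testBit_lt_two_pow (by omega), Nat.testBit_lt_two_pow (by omega)]

lemma card_perPal {n k : ℕ} (hk1 : 1 ≤ k) (hk : k ≤ n / 2) :
    ((Finset.range (2 ^ n)).filter (perPal n k)).card ≤ 2 ^ (k + n % 2) := by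
  rw [← Finset.card_range (2 ^ (k + n % 2))]
  apply Finset.card_le_card_of_injOn (fun p => (p / 2 ^ (n / 2 - k)) % 2 ^ (k + n % 2))
  · intro p _
    simp only [Finset.coe_range, Set.mem_Iio]
    exact Nat.mod_lt _ (by positivity)
  · intro p hp q hq hpq
    simp only [Finset.coe_filter, Finset.mem_range, Set.mem_ofPred_eq] at hp hq
    refine eq_of_bits hp.1 hq.1 (perPal_ext hk1 hk hp.2 hq.2 ?_)
    intro i h1 h2
    have := congrArg (fun x => x.testBit (i - (n / 2 - k))) hpq
    simp only [Nat.testBit_mod_two_pow, Nat.testBit_div_two_pow] at this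
    rw [decide_eq_true (by omega), Bool.true_and, Bool.true_and,
      show i - (n / 2 - k) + (n / 2 - k) = i by omega] at this
    exact this

/-- the two constant words -/
def constSet (n : ℕ) : Finset ℕ := {0, 2 ^ n - 1}

lemma constSet_card {n : ℕ} (hn : 1 ≤ n) : (constSet n).card = 2 := by
  unfold constSet
  apply Finset.card_pair
  have : 2 ^ 1 ≤ 2 ^ n := Nat.pow_le_pow_right (by norm_num) hn
  omega

lemma constSet_sub {n : ℕ} (k : ℕ) :
    constSet n ⊆ (Finset.range (2 ^ n)).filter (perPal n k) := by
  have hpos : 0 < 2 ^ n := by positivity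
  intro x hx
  rw [constSet, Finset.mem_insert, Finset.mem_singleton] at hx
  rw [Finset.mem_filter, Finset.mem_range]
  rcases hx with rfl | rfl
  · exact ⟨hpos, fun k _ => by simp, fun i _ => by simp⟩
  · refine ⟨by omega, fun k hk => ?_, fun i hi => ?_⟩
    · rw [Nat.testBit_two_pow_sub_one, Nat.testBit_two_pow_sub_one, decide_eq_true hk,
        decide_eq_true (by omega)]
    · rw [Nat.testBit_two_pow_sub_one, Nat.testBit_two_pow_sub_one, decide_eq_true (by omega),
        decide_eq_true (by omega)]

lemma card_union {n : ℕ} (hn : 1 ≤ n) (k : ℕ) (hk : k ≤ n / 2) :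
    (((Finset.range k).biUnion
      (fun j => (Finset.range (2 ^ n)).filter (perPal n (j + 1)))).card : ℤ) ≤
      2 + ∑ j ∈ Finset.range k, ((2 : ℤ) ^ (j + 1 + n % 2) - 2) := by
  have sub : (Finset.range k).biUnion
      (fun j => (Finset.range (2 ^ n)).filter (perPal n (j + 1))) ⊆
      constSet n ∪ (Finset.range k).biUnion
      (fun j => (Finset.range (2 ^ n)).filter (perPal n (j + 1)) \ constSet n) := by
    intro x hx
    obtain ⟨j, hj, hx⟩ := Finset.mem_biUnion.1 hx
    rw [Finset.mem_union]
    by_cases c : x ∈ constSet n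
    · exact Or.inl c
    · exact Or.inr (Finset.mem_biUnion.2 ⟨j, hj, Finset.mem_sdiff.2 ⟨hx, c⟩⟩)
  have h1 := Finset.card_le_card sub
  have h2 := Finset.card_union_le (constSet n) ((Finset.range k).biUnion
      (fun j => (Finset.range (2 ^ n)).filter (perPal n (j + 1)) \ constSet n))
  have h3 := Finset.card_biUnion_le (s := Finset.range k)
    (t := fun j => (Finset.range (2 ^ n)).filter (perPal n (j + 1)) \ constSet n)
  have h4 : ((∑ j ∈ Finset.range k,
      ((Finset.range (2 ^ n)).filter (perPal n (j + 1)) \ constSet n).card : ℕ) : ℤ) ≤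
      ∑ j ∈ Finset.range k, ((2 : ℤ) ^ (j + 1 + n % 2) - 2) := by
    push_cast
    apply Finset.sum_le_sum
    intro j hj
    have hj := Finset.mem_range.1 hj
    have a := Finset.card_sdiff_add_card_eq_card (constSet_sub (n := n) (j + 1))
    have b := card_perPal (n := n) (k := j + 1) (by omega) (by omega)
    rw [constSet_card hn] at a
    have b' : ((((Finset.range (2 ^ n)).filter (perPal n (j + 1))).card : ℕ) : ℤ) ≤
      (2 : ℤ) ^ (j + 1 + n % 2) := by exact_mod_cast b
    rw [← a] at b'
    push_cast at b'
    linarith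
  rw [constSet_card hn] at h2
  have h5 : (((Finset.range k).biUnion
      (fun j => (Finset.range (2 ^ n)).filter (perPal n (j + 1)))).card : ℤ) ≤
      2 + ((∑ j ∈ Finset.range k,
      ((Finset.range (2 ^ n)).filter (perPal n (j + 1)) \ constSet n).card : ℕ) : ℤ) := by
    exact_mod_cast (by omega)
  linarith

lemma card_pal (n : ℕ) :
    2 ^ (n / 2 + n % 2) ≤ ((Finset.range (2 ^ n)).filter (isPal n)).card := by
  rw [← Finset.card_range (2 ^ (n / 2 + n % 2))]
  let f : ℕ → ℕ := fun x => Nat.ofBits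
    (fun i : Fin n => if (i : ℕ) < n / 2 + n % 2 then x.testBit i else x.testBit (n - 1 - i))
  have hf : ∀ x i, i < n → (f x).testBit i =
      if i < n / 2 + n % 2 then x.testBit i else x.testBit (n - 1 - i) := by
    intro x i hi
    exact Nat.testBit_ofBits_lt _ _ hi
  apply Finset.card_le_card_of_injOn f
  · intro x _
    simp only [Finset.coe_filter, Finset.mem_range, Set.mem_ofPred_eq]
    refine ⟨Nat.ofBits_lt_two_pow _, ?_⟩
    intro k hk
    rw [hf _ _ hk, hf _ _ (by omega)]
    by_cases c1 : k < n / 2 + n % 2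
    · by_cases c2 : n - 1 - k < n / 2 + n % 2
      · rw [if_pos c1, if_pos c2]; congr 1; omega
      · rw [if_pos c1, if_neg c2]; congr 1; omega
    · rw [if_neg c1, if_pos (by omega)]
  · intro x hx y hy hxy
    simp only [Finset.coe_range, Set.mem_Iio] at hx hy
    refine eq_of_bits hx hy ?_
    intro i hi
    have := congrArg (fun z => z.testBit i) hxy
    rwa [hf _ _ (by omega), hf _ _ (by omega), if_pos hi, if_pos hi] at this

/-- a palindromic edge can be reached from the vertex `v` after `j` steps -/
def reach (n j v : ℕ) : Prop := ∃ q, isPal n q ∧ q % 2 ^ (n - 1 - j) = v / 2 ^ j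

lemma reach_step {n j e : ℕ} (hj : j + 2 ≤ n) (h : reach n j (e / 2)) :
    reach n (j + 1) (e % 2 ^ (n - 1)) := by
  obtain ⟨q, hq, h⟩ := h
  refine ⟨q, hq, ?_⟩
  apply Nat.eq_of_testBit_eq
  intro i
  have := congrArg (fun z => z.testBit i) h
  simp only [Nat.testBit_mod_two_pow, Nat.testBit_div_two_pow, Nat.testBit_div_two] at this ⊢
  by_cases c : i < n - 1 - (j + 1)
  · rw [decide_eq_true (show i < n - 1 - j by omega), Bool.true_and] at this
    rw [decide_eq_true c, decide_eq_true (by omega), Bool.true_and, Bool.true_and, this]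
    congr 1
  · rw [decide_eq_false c, decide_eq_false (by omega)]; rfl

lemma reach_perPal {n j p : ℕ} (hp : isPal n p) (hj : j + 1 ≤ n / 2) (h : reach n j (p / 2)) :
    perPal n (j + 1) p := by
  obtain ⟨q, hq, h⟩ := h
  refine ⟨hp, ?_⟩
  have hb : ∀ i, i < n - 1 - j → q.testBit i = p.testBit (i + j + 1) := by
    intro i hi
    have := congrArg (fun z => z.testBit i) h
    simp only [Nat.testBit_mod_two_pow, Nat.testBit_div_two_pow, Nat.testBit_div_two] at this
    rwa [decide_eq_true hi, Bool.true_and] at this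
  intro i hi
  have e1 := hp i (by omega)
  have e2 := hb (n - 1 - i - (j + 1)) (by omega)
  have e3 := hq (n - 1 - i - (j + 1)) (by omega)
  have e4 := hb (i + (j + 1)) (by omega)
  rw [show n - 1 - i - (j + 1) + j + 1 = n - 1 - i by omega] at e2
  rw [show n - 1 - (n - 1 - i - (j + 1)) = i + (j + 1) by omega] at e3
  rw [show i + (j + 1) + j + 1 = i + 2 * (j + 1) by omega] at e4
  rw [e1, ← e2, e3, e4]

open Classical in
/-- truncated distance to the next palindrome -/
noncomputable def dist' (n K v : ℕ) : ℤ :=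
  ∑ k ∈ Finset.range K, if ∀ j, j < k → ¬ reach n j v then 1 else 0

lemma dist_step {n K e : ℕ} (hK : K + 1 ≤ n) :
    dist' n (K + 1) (e % 2 ^ (n - 1)) ≤ 1 + dist' n (K + 1) (e / 2) := by
  classical
  unfold dist'
  rw [Finset.sum_range_succ', Finset.sum_range_succ]
  have h1 : ∑ k ∈ Finset.range K,
      (if ∀ j, j < k + 1 → ¬ reach n j (e % 2 ^ (n - 1)) then (1 : ℤ) else 0) ≤
      ∑ k ∈ Finset.range K, (if ∀ j, j < k → ¬ reach n j (e / 2) then (1 : ℤ) else 0) := by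
    apply Finset.sum_le_sum
    intro k hk
    have hk := Finset.mem_range.1 hk
    by_cases c : ∀ j, j < k + 1 → ¬ reach n j (e % 2 ^ (n - 1))
    · have c' : ∀ j, j < k → ¬ reach n j (e / 2) := by
        intro j hj hr
        exact c (j + 1) (by omega) (reach_step (by omega) hr)
      rw [if_pos c, if_pos c']
    · rw [if_neg c]; split_ifs <;> norm_num
  have h2 : (if ∀ j, j < 0 → ¬ reach n j (e % 2 ^ (n - 1)) then (1 : ℤ) else 0) ≤ 1 := by
    split_ifs <;> norm_num
  have h3 : 0 ≤ (if ∀ j, j < K → ¬ reach n j (e / 2) then (1 : ℤ) else 0) := by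
    split_ifs <;> norm_num
  linarith

lemma dist_pal {n K e : ℕ} (he : isPal n e) :
    dist' n (K + 1) (e % 2 ^ (n - 1)) = 1 := by
  classical
  unfold dist'
  rw [Finset.sum_range_succ']
  have h1 : ∀ k ∈ Finset.range K,
      (if ∀ j, j < k + 1 → ¬ reach n j (e % 2 ^ (n - 1)) then (1 : ℤ) else 0) = 0 := by
    intro k _
    rw [if_neg]
    intro h
    exact h 0 (by omega) ⟨e, he, by simp⟩
  rw [Finset.sum_congr rfl h1]
  simp

lemma large {n m K : ℕ} {s : ℕ → Bool} (hn : 1 ≤ n) (hK : K ≤ n / 2) (h : isOrientable s n m) :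
    2 * (m : ℤ) + ∑ k ∈ Finset.range (K + 1),
      ((2 : ℤ) ^ (n / 2 + n % 2) - (2 + ∑ j ∈ Finset.range k, ((2 : ℤ) ^ (j + 1 + n % 2) - 2)))
      ≤ 2 ^ n := by
  classical
  have hk := key n m s hn h (fun v => - dist' n (K + 1) v) (isPal n) (not_pal_W h) (not_pal_U h)
    (by
      intro e _ _
      have := dist_step (n := n) (K := K) (e := e) (by omega)
      unfold rcost
      linarith)
  have h1 : ∑ e ∈ (Finset.range (2 ^ n)).filter (isPal n),
      rcost n (fun v => - dist' n (K + 1) v) e =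
      ∑ k ∈ Finset.range (K + 1), ∑ e ∈ (Finset.range (2 ^ n)).filter (isPal n),
        if ∀ j, j < k → ¬ reach n j (e / 2) then (1 : ℤ) else 0 := by
    rw [Finset.sum_comm]
    apply Finset.sum_congr rfl
    intro e he
    have := dist_pal (K := K) (Finset.mem_filter.1 he).2
    unfold rcost
    simp only [this]
    unfold dist'
    ring
  rw [h1] at hk
  refine le_trans (add_le_add_right (Finset.sum_le_sum ?_) _) hk
  intro k hkK
  have hkK := Finset.mem_range.1 hkK
  rw [Finset.sum_boole]
  have split := Finset.card_filter_add_card_filter_not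
    (s := (Finset.range (2 ^ n)).filter (isPal n)) (fun e => ∀ j, j < k → ¬ reach n j (e / 2))
  have sub : ((Finset.range (2 ^ n)).filter (isPal n)).filter
      (fun e => ¬ ∀ j, j < k → ¬ reach n j (e / 2)) ⊆ (Finset.range k).biUnion
      (fun j => (Finset.range (2 ^ n)).filter (perPal n (j + 1))) := by
    intro e he
    obtain ⟨he, h2⟩ := Finset.mem_filter.1 he
    obtain ⟨he, h3⟩ := Finset.mem_filter.1 he
    push Not at h2
    obtain ⟨j, hj, hr⟩ := h2
    exact Finset.mem_biUnion.2 ⟨j, Finset.mem_range.2 hj, Finset.mem_filter.2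
      ⟨he, reach_perPal h3 (by omega) hr⟩⟩
  have c1 := Finset.card_le_card sub
  have c2 := card_union hn k (by omega)
  have c3 := card_pal n
  have c1' := Int.ofNat_le.2 c1
  have c3' : (2 : ℤ) ^ (n / 2 + n % 2) ≤
    (((Finset.range (2 ^ n)).filter (isPal n)).card : ℤ) := by exact_mod_cast c3
  have split' := congrArg (fun x : ℕ => (x : ℤ)) split
  simp only [Nat.cast_add] at split'
  linarith

lemma large_even {m h : ℕ} {s : ℕ → Bool} (hh : 6 ≤ h) (hs : isOrientable s (2 * h) m) :
    2 * (m : ℤ) + 6 * 2 ^ h - 96 ≤ 2 ^ (2 * h) := by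
  have := large (K := 5) (by omega) (by omega) hs
  rw [show 2 * h / 2 = h by omega, show 2 * h % 2 = 0 by omega] at this
  norm_num [Finset.sum_range_succ] at this
  linarith

lemma large_odd {m h : ℕ} {s : ℕ → Bool} (hh : 5 ≤ h) (hs : isOrientable s (2 * h + 1) m) :
    2 * (m : ℤ) + 10 * 2 ^ h - 94 ≤ 2 ^ (2 * h + 1) := by
  have := large (K := 4) (by omega) (by omega) hs
  rw [show (2 * h + 1) / 2 = h by omega, show (2 * h + 1) % 2 = 1 by omega] at this
  norm_num [Finset.sum_range_succ] at this
  have e : (2 : ℤ) ^ (h + 1) = 2 * 2 ^ h := by ring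
  rw [e] at this
  linarith

/-- Theorem 2 (Dai et al.): the upper bound on the period of an orientable
sequence of order `n ≥ 5`. -/
theorem dai_bound (n m : ℕ) (s : ℕ → Bool) (hn : 5 ≤ n)
    (h : isOrientable s n m) :
    (n % 4 = 0 → (m : ℚ) ≤ 2 ^ (n - 1) - 41 / 9 * 2 ^ (n / 2 - 1) + n / 3 + 16 / 9) ∧
    (n % 4 = 1 → (m : ℚ) ≤ 2 ^ (n - 1) - 31 / 9 * 2 ^ ((n - 1) / 2) + n / 3 + 19 / 9) ∧
    (n % 4 = 2 → (m : ℚ) ≤ 2 ^ (n - 1) - 41 / 9 * 2 ^ (n / 2 - 1) + n / 6 + 20 / 9) ∧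
    (n % 4 = 3 → (m : ℚ) ≤ 2 ^ (n - 1) - 31 / 9 * 2 ^ ((n - 1) / 2) + n / 6 + 43 / 18) := by
  by_cases hlt : n < 11
  · interval_cases n
    · have := small_5 h
      norm_num at this ⊢
      have : (2 * m + 20 : ℚ) ≤ 32 := by exact_mod_cast this
      linarith
    · have := small_6 h
      norm_num at this ⊢
      have : (2 * m + 30 : ℚ) ≤ 64 := by exact_mod_cast this
      linarith
    · have := small_7 h
      norm_num at this ⊢
      have : (2 * m + 48 : ℚ) ≤ 128 := by exact_mod_cast this
      linarith
    · have := small_8 h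
      norm_num at this ⊢
      have : (2 * m + 64 : ℚ) ≤ 256 := by exact_mod_cast this
      linarith
    · have := small_9 h
      norm_num at this ⊢
      have : (2 * m + 100 : ℚ) ≤ 512 := by exact_mod_cast this
      linarith
    · have := small_10 h
      norm_num at this ⊢
      have : (2 * m + 138 : ℚ) ≤ 1024 := by exact_mod_cast this
      linarith
  · obtain ⟨q, hq | hq⟩ : ∃ q, n = 2 * q ∨ n = 2 * q + 1 := ⟨n / 2, by omega⟩
    · subst hq
      have hl : (2 * (m : ℚ) + 6 * 2 ^ q - 96) ≤ 2 ^ (2 * q) := by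
        exact_mod_cast large_even (by omega) h
      have e1 : (2 : ℚ) ^ (2 * q) = 2 * 2 ^ (2 * q - 1) := by
        rw [← pow_succ']; congr 1; omega
      have e2 : (2 : ℚ) ^ q = 2 * 2 ^ (2 * q / 2 - 1) := by
        rw [← pow_succ']; congr 1; omega
      have hp : (2 : ℚ) ^ 5 ≤ 2 ^ (2 * q / 2 - 1) := pow_le_pow_right₀ (by norm_num) (by omega)
      have hc : (6 : ℚ) ≤ q := by exact_mod_cast (by omega : 6 ≤ q)
      rw [e1, e2] at hl
      refine ⟨fun _ => ?_, fun _ => by omega, fun _ => ?_, fun _ => by omega⟩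
      · push_cast
        linarith
      · have hp : (2 : ℚ) ^ 6 ≤ 2 ^ (2 * q / 2 - 1) := pow_le_pow_right₀ (by norm_num) (by omega)
        push_cast
        linarith
    · subst hq
      have hl : (2 * (m : ℚ) + 10 * 2 ^ q - 94) ≤ 2 ^ (2 * q + 1) := by
        exact_mod_cast large_odd (by omega) h
      have e1 : (2 : ℚ) ^ (2 * q + 1) = 2 * 2 ^ (2 * q + 1 - 1) := by
        rw [← pow_succ']; congr 1
      have e2 : (2 * q + 1 - 1) / 2 = q := by omega
      have hp : (2 : ℚ) ^ 5 ≤ 2 ^ q := pow_le_pow_right₀ (by norm_num) (by omega)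
      have hc : (5 : ℚ) ≤ q := by exact_mod_cast (by omega : 5 ≤ q)
      rw [e1] at hl
      rw [e2]
      rw [Nat.add_sub_cancel] at hl ⊢
      refine ⟨fun _ => by omega, fun _ => ?_, fun _ => by omega, fun _ => ?_⟩
      · push_cast
        linarith
      · push_cast
        linarith
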